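/- arXiv:2510.06425 — 5 statements merged into one kernel-verified Lean document; each statement's English description precedes it below -/
import Mathlib

section
/- The Bargmann kernel reproduces itself under Gaussian integration: for all β, δ ∈ ℂ, ∫_ℂ exp(conj(β)·γ) · exp(conj(γ)·δ) dP(γ) = exp(conj(β)·δ). -/
open MeasureTheory Complex

/-- The Gaussian probability measure `P` on `ℂ`, the pushforward of the product of two
standard Gaussians on `ℝ` under `(x, y) ↦ (x + i y)/√2`. -/
noncomputable def gaussP : Measure ℂ :=
  Measure.map (fun p : ℝ × ℝ => ((p.1 : ℂ) + (p.2 : ℂ) * Complex.I) / (Real.sqrt 2 : ℂ))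
    ((ProbabilityTheory.gaussianReal 0 1).prod (ProbabilityTheory.gaussianReal 0 1))

theorem integral_cexp_mul_gaussianReal (z : ℂ) :
    ∫ x : ℝ, Complex.exp (z * x) ∂(ProbabilityTheory.gaussianReal 0 1)
      = Complex.exp (z ^ 2 / 2) := by
  simpa [ProbabilityTheory.complexMGF] using
    ProbabilityTheory.complexMGF_gaussianReal
      (Measure.map_id (μ := ProbabilityTheory.gaussianReal 0 1)) z

/-- The Bargmann kernel reproduces itself under Gaussian integration:
`∫ exp(conj(β)·γ) exp(conj(γ)·δ) dP(γ) = exp(conj(β)·δ)`. -/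
theorem bargmann_kernel_reproducing (β δ : ℂ) :
    ∫ γ, Complex.exp ((starRingEnd ℂ) β * γ) * Complex.exp ((starRingEnd ℂ) γ * δ) ∂gaussP
      = Complex.exp ((starRingEnd ℂ) β * δ) := by
  have sqrt_two_sq : (Real.sqrt 2 : ℂ) ^ 2 = 2 := by
    rw [← Complex.ofReal_pow, Real.sq_sqrt (by norm_num)]
    simp
  rw [gaussP, integral_map (by fun_prop)
    (Continuous.aestronglyMeasurable (by fun_prop))]
  set b := (starRingEnd ℂ) β
  have factor : ∀ p : ℝ × ℝ,
      Complex.exp (b * (((p.1 : ℂ) + (p.2 : ℂ) * Complex.I) / (Real.sqrt 2 : ℂ))) *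
        Complex.exp ((starRingEnd ℂ)
          (((p.1 : ℂ) + (p.2 : ℂ) * Complex.I) / (Real.sqrt 2 : ℂ)) * δ)
      = Complex.exp ((b + δ) / (Real.sqrt 2 : ℂ) * p.1) *
        Complex.exp ((b - δ) * Complex.I / (Real.sqrt 2 : ℂ) * p.2) := by
    intro p
    rw [← Complex.exp_add, ← Complex.exp_add]
    simp only [map_div₀, map_add, map_mul, Complex.conj_ofReal, Complex.conj_I]
    ring_nf
  simp_rw [factor]
  rw [integral_prod_mul (fun x : ℝ => Complex.exp ((b + δ) / (Real.sqrt 2 : ℂ) * x))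
    (fun y : ℝ => Complex.exp ((b - δ) * Complex.I / (Real.sqrt 2 : ℂ) * y)),
    integral_cexp_mul_gaussianReal, integral_cexp_mul_gaussianReal, ← Complex.exp_add]
  congr 1
  rw [div_pow, div_pow, mul_pow, sqrt_two_sq, Complex.I_sq]
  ring
end

section
/- The representer functions of the Bargmann kernel have the reproducing property on anti-holomorphic monomials: for every β ∈ ℂ and every natural number n, ∫_ℂ exp(α·conj(β)) · conj(α)^n dP(α) = conj(β)^n. (Equivalently, ⟨k_β, f⟩_{L²(ℂ,P)} = f(conj(β)) for f(ᾱ) = ᾱ^n, where k_β(α) = exp(conj(α)·β), since conj(k_β(α)) = exp(α·conj(β)).) -/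
open MeasureTheory Complex

/-- `gaussP` is the image of a Gaussian measure under a continuous linear map. -/
lemma isGaussian_gaussP : ProbabilityTheory.IsGaussian gaussP := by
  let L : ℝ × ℝ →L[ℝ] ℂ :=
    (Real.sqrt 2 : ℂ)⁻¹ • (Complex.ofRealCLM ∘L ContinuousLinearMap.fst ℝ ℝ ℝ +
      Complex.I • Complex.ofRealCLM ∘L ContinuousLinearMap.snd ℝ ℝ ℝ)
  have hL : (fun p : ℝ × ℝ => ((p.1 : ℂ) + (p.2 : ℂ) * Complex.I) / (Real.sqrt 2 : ℂ)) = L := by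
    ext p
    simp [L]
    ring
  rw [gaussP, hL]
  infer_instance

/-- A Gaussian measure on a Banach space has all moments weighted by exponentials of the norm. -/
lemma integrable_norm_pow_mul_exp_norm {E : Type*} [NormedAddCommGroup E] [NormedSpace ℝ E]
    [MeasurableSpace E] [BorelSpace E] [SecondCountableTopology E] [CompleteSpace E]
    (μ : Measure E) [ProbabilityTheory.IsGaussian μ] (n : ℕ) (c : ℝ) :
    Integrable (fun x => ‖x‖ ^ n * Real.exp (c * ‖x‖)) μ := by
  obtain ⟨C, hC, hint⟩ := ProbabilityTheory.IsGaussian.exists_integrable_exp_sq μ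
  refine (hint.const_mul (n.factorial * Real.exp ((c + 1) ^ 2 / (4 * C)))).mono'
    (by fun_prop) (.of_forall fun x => ?_)
  have hpow : ‖x‖ ^ n ≤ n.factorial * Real.exp ‖x‖ := by
    have h := Real.pow_div_factorial_le_exp ‖x‖ (norm_nonneg x) n
    rwa [div_le_iff₀' (by positivity)] at h
  have hsq : (c + 1) * ‖x‖ ≤ (c + 1) ^ 2 / (4 * C) + C * ‖x‖ ^ 2 := by
    have h : (c + 1) ^ 2 / (4 * C) + C * ‖x‖ ^ 2 - (c + 1) * ‖x‖
        = (c + 1 - 2 * C * ‖x‖) ^ 2 / (4 * C) := by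
      field_simp
      ring
    have : 0 ≤ (c + 1 - 2 * C * ‖x‖) ^ 2 / (4 * C) := by positivity
    linarith
  rw [Real.norm_of_nonneg (by positivity)]
  calc ‖x‖ ^ n * Real.exp (c * ‖x‖)
      ≤ n.factorial * Real.exp ‖x‖ * Real.exp (c * ‖x‖) := by gcongr
    _ = n.factorial * Real.exp ((c + 1) * ‖x‖) := by
        rw [mul_assoc, ← Real.exp_add]
        ring_nf
    _ ≤ n.factorial * Real.exp ((c + 1) ^ 2 / (4 * C) + C * ‖x‖ ^ 2) := by gcongr
    _ = n.factorial * Real.exp ((c + 1) ^ 2 / (4 * C)) * Real.exp (C * ‖x‖ ^ 2) := by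
        rw [Real.exp_add, mul_assoc]

lemma integral_exp_mul_gaussianReal (z : ℂ) :
    ∫ x : ℝ, Complex.exp (z * x) ∂ProbabilityTheory.gaussianReal 0 1
      = Complex.exp (z ^ 2 / 2) := by
  simpa [ProbabilityTheory.complexMGF] using
    ProbabilityTheory.complexMGF_id_gaussianReal (μ := 0) (v := 1) z

/-- The joint exponential generating function of the moments `∫ α ^ m * conj α ^ n ∂gaussP`. -/
lemma integral_exp_add_conj_gaussP (b w : ℂ) :
    ∫ α, Complex.exp (α * b + (starRingEnd ℂ) α * w) ∂gaussP = Complex.exp (b * w) := by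
  have hs : (Real.sqrt 2 : ℂ) ^ 2 = 2 := by
    rw [← Complex.ofReal_pow, Real.sq_sqrt (by norm_num), Complex.ofReal_ofNat]
  have hs0 : (Real.sqrt 2 : ℂ) ≠ 0 := by simp
  rw [gaussP, integral_map (by fun_prop)
    (Continuous.aestronglyMeasurable (by fun_prop))]
  have hsplit (p : ℝ × ℝ) :
      Complex.exp (((p.1 : ℂ) + (p.2 : ℂ) * Complex.I) / (Real.sqrt 2 : ℂ) * b +
        (starRingEnd ℂ) (((p.1 : ℂ) + (p.2 : ℂ) * Complex.I) / (Real.sqrt 2 : ℂ)) * w)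
      = Complex.exp ((b + w) / (Real.sqrt 2 : ℂ) * p.1) *
        Complex.exp (Complex.I * (b - w) / (Real.sqrt 2 : ℂ) * p.2) := by
    rw [← Complex.exp_add]
    simp only [map_div₀, map_add, map_mul, Complex.conj_ofReal, Complex.conj_I]
    ring_nf
  simp_rw [hsplit]
  rw [integral_prod_mul (fun x : ℝ => Complex.exp ((b + w) / (Real.sqrt 2 : ℂ) * x))
    (fun y : ℝ => Complex.exp (Complex.I * (b - w) / (Real.sqrt 2 : ℂ) * y)),
    integral_exp_mul_gaussianReal, integral_exp_mul_gaussianReal, ← Complex.exp_add,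
    div_pow, div_pow, mul_pow, hs, Complex.I_sq]
  ring_nf

lemma norm_exp_add_conj_mul_pow_le (b w α : ℂ) (n : ℕ) :
    ‖Complex.exp (α * b + (starRingEnd ℂ) α * w) * (starRingEnd ℂ) α ^ n‖
      ≤ ‖α‖ ^ n * Real.exp ((‖b‖ + ‖w‖) * ‖α‖) := by
  rw [norm_mul, norm_pow, RCLike.norm_conj, mul_comm]
  gcongr
  refine (Complex.norm_exp_le_exp_norm _).trans (Real.exp_le_exp.2 ?_)
  refine (norm_add_le _ _).trans_eq ?_
  rw [norm_mul, norm_mul, RCLike.norm_conj]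
  ring

/-- Differentiation under the integral sign in the anti-holomorphic exponent. -/
lemma hasDerivAt_integral_exp_add_conj_mul_pow_gaussP (b w : ℂ) (n : ℕ) :
    HasDerivAt
      (fun w => ∫ α, Complex.exp (α * b + (starRingEnd ℂ) α * w) *
        (starRingEnd ℂ) α ^ n ∂gaussP)
      (∫ α, Complex.exp (α * b + (starRingEnd ℂ) α * w) *
        (starRingEnd ℂ) α ^ (n + 1) ∂gaussP) w := by
  have := isGaussian_gaussP
  have hmeas (v : ℂ) (m : ℕ) : AEStronglyMeasurable
      (fun α => Complex.exp (α * b + (starRingEnd ℂ) α * v) * (starRingEnd ℂ) α ^ m) gaussP :=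
    Continuous.aestronglyMeasurable (by fun_prop)
  refine (hasDerivAt_integral_of_dominated_loc_of_deriv_le
    (F := fun v α => Complex.exp (α * b + (starRingEnd ℂ) α * v) * (starRingEnd ℂ) α ^ n)
    (F' := fun v α =>
      Complex.exp (α * b + (starRingEnd ℂ) α * v) * (starRingEnd ℂ) α ^ (n + 1))
    (Metric.ball_mem_nhds w one_pos) (.of_forall fun v => hmeas v n)
    ((integrable_norm_pow_mul_exp_norm gaussP n _).mono' (hmeas w n)
      (.of_forall fun α => norm_exp_add_conj_mul_pow_le b w α n))
    (hmeas w (n + 1)) (.of_forall fun α v hv => ?_)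
    (integrable_norm_pow_mul_exp_norm gaussP (n + 1) (‖b‖ + (‖w‖ + 1)))
    (.of_forall fun α v _ => ?_)).2
  · have hv' : ‖v‖ ≤ ‖w‖ + 1 := by
      have h := norm_le_norm_add_norm_sub' v w
      rw [Metric.mem_ball, dist_eq_norm] at hv
      linarith
    exact (norm_exp_add_conj_mul_pow_le b v α (n + 1)).trans (by gcongr)
  · have h := ((((hasDerivAt_id v).const_mul ((starRingEnd ℂ) α)).const_add
      (α * b)).cexp).mul_const ((starRingEnd ℂ) α ^ n)
    refine h.congr_deriv ?_
    simp only [id_eq]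
    ring

lemma integral_exp_add_conj_mul_pow_gaussP (b w : ℂ) (n : ℕ) :
    ∫ α, Complex.exp (α * b + (starRingEnd ℂ) α * w) * (starRingEnd ℂ) α ^ n ∂gaussP
      = Complex.exp (b * w) * b ^ n := by
  induction n generalizing w with
  | zero => simpa using integral_exp_add_conj_gaussP b w
  | succ n ih =>
    have h := hasDerivAt_integral_exp_add_conj_mul_pow_gaussP b w n
    simp_rw [ih] at h
    refine h.unique ((((hasDerivAt_id w).const_mul b).cexp.mul_const (b ^ n)).congr_deriv ?_)
    simp only [id_eq]
    ring

/-- Reproducing property of the Bargmann representers on anti-holomorphic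
monomials: for every `β ∈ ℂ` and `n ∈ ℕ`,
`∫ exp(α·conj(β)) conj(α)^n dP(α) = conj(β)^n`. -/
theorem bargmann_representer_reproduces (β : ℂ) (n : ℕ) :
    ∫ α, Complex.exp (α * (starRingEnd ℂ) β) * ((starRingEnd ℂ) α) ^ n ∂gaussP
      = ((starRingEnd ℂ) β) ^ n := by
  simpa using integral_exp_add_conj_mul_pow_gaussP ((starRingEnd ℂ) β) 0 n
end

section
/- Single-mode anti-Wick ordering via doubling and partial vacuum expectation: let C = ∂/∂X + (multiplication by Y) and C* = (multiplication by X) + ∂/∂Y as endomorphisms of ℂ[X,Y], and let ℰ : ℂ[X,Y] → ℂ[X] extract the coefficient of Y⁰ (the Y-constant part). Then for all natural numbers n, m and every polynomial p ∈ ℂ[X], viewing p as an element of ℂ[X,Y], one has ℰ( (C*)^n ( C^m p ) ) = (∂/∂X)^m ( X^n · p ). That is, the partial vacuum expectation of the commuting operators C, C* applied to p reproduces the anti-Wick ordered operator a^m (a*)^n, where a = ∂/∂X and a* = multiplication by X. -/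
open MvPolynomial

/-- Annihilation operator `a = ∂/∂X` on `ℂ[X,Y]` (with `X` the variable `0`). -/
noncomputable def aOp : Module.End ℂ (MvPolynomial (Fin 2) ℂ) :=
  (pderiv (0 : Fin 2)).toLinearMap

/-- `C = ∂/∂X + multiplication by Y` on `ℂ[X,Y]`. -/
noncomputable def cOp : Module.End ℂ (MvPolynomial (Fin 2) ℂ) :=
  (pderiv (0 : Fin 2)).toLinearMap + LinearMap.mulLeft ℂ (X (1 : Fin 2))

/-- `C* = multiplication by X + ∂/∂Y` on `ℂ[X,Y]`. -/
noncomputable def cStarOp : Module.End ℂ (MvPolynomial (Fin 2) ℂ) :=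
  LinearMap.mulLeft ℂ (X (0 : Fin 2)) + (pderiv (1 : Fin 2)).toLinearMap

/-- The partial vacuum expectation `ℰ : ℂ[X,Y] → ℂ[X]`: substitute `Y := 0`, which extracts
the coefficient of `Y⁰` (the `Y`-constant part). -/
noncomputable def vacB : MvPolynomial (Fin 2) ℂ →ₐ[ℂ] MvPolynomial (Fin 2) ℂ :=
  aeval ![X (0 : Fin 2), 0]

theorem commute_cStarOp_cOp : Commute cStarOp cOp := by
  refine LinearMap.ext fun q => ?_
  have hcomm : pderiv (0 : Fin 2) (pderiv (1 : Fin 2) q) = pderiv 1 (pderiv 0 q) := by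
    have h : ⁅pderiv (R := ℂ) (0 : Fin 2), pderiv (1 : Fin 2)⁆ = 0 :=
      MvPolynomial.derivation_ext fun i => by
        rw [Derivation.commutator_apply, pderiv_X, pderiv_X]
        fin_cases i <;> simp
    simpa [Derivation.commutator_apply, sub_eq_zero] using congrArg (fun D => D q) h
  simp [cStarOp, cOp, pderiv_X, hcomm]
  ring

theorem vacB_pderiv_zero (q : MvPolynomial (Fin 2) ℂ) :
    vacB (pderiv 0 q) = pderiv 0 (vacB q) := by
  induction q using MvPolynomial.induction_on with
  | C a => simp [vacB]
  | add p q hp hq => simp [hp, hq]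
  | mul_X p i hp =>
    fin_cases i <;> simp_all [vacB, pderiv_X]

theorem vacB_cOp (q : MvPolynomial (Fin 2) ℂ) : vacB (cOp q) = aOp (vacB q) := by
  have hY : vacB (X 1) = 0 := by simp [vacB]
  simp [cOp, aOp, vacB_pderiv_zero, hY]

theorem vacB_cOp_pow (m : ℕ) (q : MvPolynomial (Fin 2) ℂ) :
    vacB ((cOp ^ m) q) = (aOp ^ m) (vacB q) := by
  induction m generalizing q with
  | zero => rfl
  | succ m ih => rw [pow_succ, pow_succ, Module.End.mul_apply, Module.End.mul_apply, ih, vacB_cOp]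

theorem pderiv_one_eq_zero {p : MvPolynomial (Fin 2) ℂ}
    (hp : p ∈ supported ℂ ({0} : Set (Fin 2))) : pderiv 1 p = 0 := by
  refine pderiv_eq_zero_of_notMem_vars fun h => ?_
  simpa using mem_supported.1 hp h

theorem vacB_eq_self {p : MvPolynomial (Fin 2) ℂ}
    (hp : p ∈ supported ℂ ({0} : Set (Fin 2))) : vacB p = p := by
  have h : Set.EqOn vacB (AlgHom.id ℂ _) (supported ℂ ({0} : Set (Fin 2))) :=
    AlgHom.eqOn_adjoin_iff.2 (by simp [Set.EqOn, vacB])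
  exact h hp

theorem cStarOp_pow_apply (n : ℕ) {p : MvPolynomial (Fin 2) ℂ}
    (hp : p ∈ supported ℂ ({0} : Set (Fin 2))) : (cStarOp ^ n) p = X 0 ^ n * p := by
  induction n with
  | zero => simp
  | succ n ih =>
    rw [pow_succ', Module.End.mul_apply, ih]
    simp [cStarOp, Derivation.leibniz_pow, pderiv_X, pderiv_one_eq_zero hp]
    ring

/-- Single-mode anti-Wick ordering via doubling and partial vacuum
expectation: for all `n m : ℕ` and every polynomial `p ∈ ℂ[X]` (viewed inside `ℂ[X,Y]`),
`ℰ((C*)^n (C^m p)) = (∂/∂X)^m (Xⁿ · p)`, i.e. the anti-Wick ordered operator `aᵐ (a*)ⁿ`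
applied to `p`. -/
theorem antiWick_single_mode (n m : ℕ) (p : MvPolynomial (Fin 2) ℂ)
    (hp : p ∈ supported ℂ ({0} : Set (Fin 2))) :
    vacB ((cStarOp ^ n) ((cOp ^ m) p)) = (aOp ^ m) ((X (0 : Fin 2)) ^ n * p) := by
  have hX : (X 0 ^ n * p : MvPolynomial (Fin 2) ℂ) ∈ supported ℂ ({0} : Set (Fin 2)) :=
    Subalgebra.mul_mem _ (Subalgebra.pow_mem _ (X_mem_supported.2 (Set.mem_singleton 0)) n) hp
  rw [← Module.End.mul_apply, (commute_cStarOp_cOp.pow_pow n m).eq, Module.End.mul_apply,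
    cStarOp_pow_apply n hp, vacB_cOp_pow, vacB_eq_self hX]
end

section
/- Anti-Wick ordering of fields via partial vacuum expectation: let d ≥ 1, and for φ ∈ ℂ^d let Z(φ) = Σᵢ conj(φᵢ)·(∂/∂Xᵢ + multiplication by Yᵢ) and Z(ψ)* = Σᵢ ψᵢ·(multiplication by Xᵢ + ∂/∂Yᵢ) on ℂ[X₁,…,X_d,Y₁,…,Y_d], and let ℰ_A : ℂ[X₁,…,X_d,Y₁,…,Y_d] → ℂ[X₁,…,X_d] extract the part of total Y-degree zero. Then for all n, m ≥ 0, all φ₁,…,φₙ, ψ₁,…,ψₘ ∈ ℂ^d and every p ∈ ℂ[X₁,…,X_d], viewing p as an element of ℂ[X₁,…,X_d,Y₁,…,Y_d], one has ℰ_A( Z(φ₁) ∘ ⋯ ∘ Z(φₙ) ∘ Z(ψ₁)* ∘ ⋯ ∘ Z(ψₘ)* applied to p ) = A(φ₁) ∘ ⋯ ∘ A(φₙ) ∘ A(ψ₁)* ∘ ⋯ ∘ A(ψₘ)* applied to p, where A(φ) = Σᵢ conj(φᵢ) ∂/∂Xᵢ and A(ψ)* = multiplication by Σᵢ ψᵢ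 Xᵢ. That is, the partial vacuum expectation of a monomial in the commuting fields Z, Z* is the corresponding anti-Wick (anti-normally) ordered monomial in A, A*. -/
open MvPolynomial

/-- The annihilation field `A(φ) = Σᵢ conj(φᵢ) ∂/∂Xᵢ` on `ℂ[X₁,…,X_d,Y₁,…,Y_d]`
(the `X`-variables are indexed by `Sum.inl`, the `Y`-variables by `Sum.inr`). -/
noncomputable def Aop (d : ℕ) (φ : Fin d → ℂ) :
    Module.End ℂ (MvPolynomial (Fin d ⊕ Fin d) ℂ) :=
  ∑ i, (starRingEnd ℂ) (φ i) • (pderiv (Sum.inl i)).toLinearMap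

/-- The creation field `A(ψ)* = multiplication by Σᵢ ψᵢ Xᵢ`. -/
noncomputable def AstarOp (d : ℕ) (ψ : Fin d → ℂ) :
    Module.End ℂ (MvPolynomial (Fin d ⊕ Fin d) ℂ) :=
  LinearMap.mulLeft ℂ (∑ i, MvPolynomial.C (ψ i) * X (Sum.inl i))

/-- The doubled-up field `Z(φ) = A(φ) + B(Jφ)* = Σᵢ conj(φᵢ)·(∂/∂Xᵢ + mult. by Yᵢ)`. -/
noncomputable def Zop (d : ℕ) (φ : Fin d → ℂ) :
    Module.End ℂ (MvPolynomial (Fin d ⊕ Fin d) ℂ) :=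
  ∑ i, (starRingEnd ℂ) (φ i) •
    ((pderiv (Sum.inl i)).toLinearMap + LinearMap.mulLeft ℂ (X (Sum.inr i)))

/-- The adjoint field `Z(ψ)* = A(ψ)* + B(Jψ) = Σᵢ ψᵢ·(mult. by Xᵢ + ∂/∂Yᵢ)`. -/
noncomputable def ZstarOp (d : ℕ) (ψ : Fin d → ℂ) :
    Module.End ℂ (MvPolynomial (Fin d ⊕ Fin d) ℂ) :=
  ∑ i, (ψ i) •
    (LinearMap.mulLeft ℂ (X (Sum.inl i)) + (pderiv (Sum.inr i)).toLinearMap)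

/-- The partial vacuum expectation `ℰ_A : ℂ[X,Y] → ℂ[X]` with respect to the `Y`-modes:
substitute every `Yᵢ := 0`, extracting the part of total `Y`-degree zero. -/
noncomputable def vacBfield (d : ℕ) :
    MvPolynomial (Fin d ⊕ Fin d) ℂ →ₐ[ℂ] MvPolynomial (Fin d ⊕ Fin d) ℂ :=
  aeval (Sum.elim (fun i => X (Sum.inl i)) (fun _ => 0))

/-- Setting the `Y`-variables to zero commutes with differentiation in an `X`-variable. -/
theorem vacBfield_pderiv_inl (d : ℕ) (i : Fin d) (q : MvPolynomial (Fin d ⊕ Fin d) ℂ) :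
    vacBfield d (pderiv (Sum.inl i) q) = pderiv (Sum.inl i) (vacBfield d q) := by
  induction q using MvPolynomial.induction_on with
  | C a => simp [vacBfield]
  | add p q hp hq => simp only [map_add, hp, hq]
  | mul_X p j hp =>
    simp only [Derivation.leibniz, smul_eq_mul, map_add, map_mul, hp]
    cases j with
    | inl j => by_cases h : j = i <;> simp [vacBfield, pderiv_X, h]
    | inr j => simp [vacBfield, pderiv_X]

/-- The partial vacuum expectation intertwines `Z(φ)` and `A(φ)`. -/
theorem vacBfield_Zop (d : ℕ) (φ : Fin d → ℂ) (q : MvPolynomial (Fin d ⊕ Fin d) ℂ) :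
    vacBfield d (Zop d φ q) = Aop d φ (vacBfield d q) := by
  have hY (i : Fin d) : vacBfield d (X (Sum.inr i)) = 0 := by simp [vacBfield]
  simp [Zop, Aop, LinearMap.sum_apply, vacBfield_pderiv_inl, hY]

theorem vacBfield_prod_Zop (d : ℕ) (L : List (Fin d → ℂ))
    (q : MvPolynomial (Fin d ⊕ Fin d) ℂ) :
    vacBfield d ((L.map (Zop d)).prod q) = (L.map (Aop d)).prod (vacBfield d q) := by
  induction L with
  | nil => simp
  | cons φ L ih => simp [Module.End.mul_apply, vacBfield_Zop, ih]

theorem vacBfield_of_mem_supported (d : ℕ) {p : MvPolynomial (Fin d ⊕ Fin d) ℂ}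
    (hp : p ∈ supported ℂ (Set.range (Sum.inl : Fin d → Fin d ⊕ Fin d))) :
    vacBfield d p = p := by
  rw [supported_eq_range_rename] at hp
  obtain ⟨q, rfl⟩ := hp
  change vacBfield d (rename Subtype.val q) = rename Subtype.val q
  have h : (vacBfield d).comp (rename (Subtype.val : Set.range Sum.inl → Fin d ⊕ Fin d)) =
      rename Subtype.val := by
    ext ⟨_, j, rfl⟩ : 1
    simp [vacBfield]
  exact DFunLike.congr_fun h q

/-- On polynomials in the `X`-variables alone, `Z(ψ)*` acts as `A(ψ)*`. -/
theorem ZstarOp_of_mem_supported (d : ℕ) (ψ : Fin d → ℂ)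
    {p : MvPolynomial (Fin d ⊕ Fin d) ℂ}
    (hp : p ∈ supported ℂ (Set.range (Sum.inl : Fin d → Fin d ⊕ Fin d))) :
    ZstarOp d ψ p = AstarOp d ψ p := by
  have hY (i : Fin d) : pderiv (Sum.inr i) p = 0 :=
    pderiv_eq_zero_of_notMem_vars fun h => by simpa using mem_supported.1 hp h
  simp [ZstarOp, AstarOp, LinearMap.sum_apply, hY, Finset.sum_mul, smul_eq_C_mul, mul_assoc]

theorem AstarOp_mem_supported (d : ℕ) (ψ : Fin d → ℂ)
    {p : MvPolynomial (Fin d ⊕ Fin d) ℂ}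
    (hp : p ∈ supported ℂ (Set.range (Sum.inl : Fin d → Fin d ⊕ Fin d))) :
    AstarOp d ψ p ∈ supported ℂ (Set.range (Sum.inl : Fin d → Fin d ⊕ Fin d)) :=
  mul_mem (sum_mem fun i _ => mul_mem (Subalgebra.algebraMap_mem _ (ψ i))
    (X_mem_supported.2 ⟨i, rfl⟩)) hp

theorem prod_AstarOp_mem_supported (d : ℕ) (L : List (Fin d → ℂ))
    {p : MvPolynomial (Fin d ⊕ Fin d) ℂ}
    (hp : p ∈ supported ℂ (Set.range (Sum.inl : Fin d → Fin d ⊕ Fin d))) :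
    (L.map (AstarOp d)).prod p ∈ supported ℂ (Set.range (Sum.inl : Fin d → Fin d ⊕ Fin d)) := by
  induction L with
  | nil => simpa using hp
  | cons ψ L ih => simpa [Module.End.mul_apply] using AstarOp_mem_supported d ψ ih

theorem prod_ZstarOp_of_mem_supported (d : ℕ) (L : List (Fin d → ℂ))
    {p : MvPolynomial (Fin d ⊕ Fin d) ℂ}
    (hp : p ∈ supported ℂ (Set.range (Sum.inl : Fin d → Fin d ⊕ Fin d))) :
    (L.map (ZstarOp d)).prod p = (L.map (AstarOp d)).prod p := by
  induction L with
  | nil => simp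
  | cons ψ L ih =>
    simp only [List.map_cons, List.prod_cons, Module.End.mul_apply, ih]
    exact ZstarOp_of_mem_supported d ψ (prod_AstarOp_mem_supported d L hp)

/-- Anti-Wick ordering of fields via partial vacuum expectation: for all
`φ₁,…,φₙ, ψ₁,…,ψₘ ∈ ℂ^d` and every `p ∈ ℂ[X₁,…,X_d]` (viewed inside `ℂ[X,Y]`),
`ℰ_A(Z(φ₁)⋯Z(φₙ) Z(ψ₁)*⋯Z(ψₘ)* p) = A(φ₁)⋯A(φₙ) A(ψ₁)*⋯A(ψₘ)* p`. -/
theorem antiWick_fields (d : ℕ) (hd : 1 ≤ d) (n m : ℕ)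
    (φ : Fin n → Fin d → ℂ) (ψ : Fin m → Fin d → ℂ)
    (p : MvPolynomial (Fin d ⊕ Fin d) ℂ)
    (hp : p ∈ supported ℂ (Set.range (Sum.inl : Fin d → Fin d ⊕ Fin d))) :
    vacBfield d
        (((List.ofFn fun j => Zop d (φ j)).prod * (List.ofFn fun k => ZstarOp d (ψ k)).prod) p)
      = ((List.ofFn fun j => Aop d (φ j)).prod * (List.ofFn fun k => AstarOp d (ψ k)).prod) p := by
  have hmap {k : ℕ} (f : (Fin d → ℂ) → Module.End ℂ (MvPolynomial (Fin d ⊕ Fin d) ℂ))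
      (v : Fin k → Fin d → ℂ) : (List.ofFn fun j => f (v j)) = (List.ofFn v).map f :=
    List.map_ofFn.symm
  rw [hmap, hmap, hmap, hmap, Module.End.mul_apply, Module.End.mul_apply, vacBfield_prod_Zop,
    prod_ZstarOp_of_mem_supported d _ hp,
    vacBfield_of_mem_supported d (prod_AstarOp_mem_supported d _ hp)]
end

section
/- Partial vacuum expectation with respect to the A-modes: with the same setup, let ℰ_B : ℂ[X₁,…,X_d,Y₁,…,Y_d] → ℂ[Y₁,…,Y_d] extract the part of total X-degree zero. Then for all n, m ≥ 0, all φ₁,…,φₙ, ψ₁,…,ψₘ ∈ ℂ^d and every q ∈ ℂ[Y₁,…,Y_d], viewing q as an element of ℂ[X₁,…,X_d,Y₁,…,Y_d], one has ℰ_B( Z(φ₁) ∘ ⋯ ∘ Z(φₙ) ∘ Z(ψ₁)* ∘ ⋯ ∘ Z(ψₘ)* applied to q ) = B(Jψ₁) ∘ ⋯ ∘ B(Jψₘ) ∘ B(Jφ₁)* ∘ ⋯ ∘ B(Jφₙ)* applied to q, where B(φ) = Σᵢ conj(φᵢ) ∂/∂Yᵢ and B(ψ)* = multiplication by Σᵢ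 ψᵢ Yᵢ, and J is componentwise conjugation. -/
open MvPolynomial

/-- The annihilation field `B(φ) = Σᵢ conj(φᵢ) ∂/∂Yᵢ` on `ℂ[X₁,…,X_d,Y₁,…,Y_d]`
(the `X`-variables are indexed by `Sum.inl`, the `Y`-variables by `Sum.inr`). -/
noncomputable def Bop (d : ℕ) (φ : Fin d → ℂ) :
    Module.End ℂ (MvPolynomial (Fin d ⊕ Fin d) ℂ) :=
  ∑ i, (starRingEnd ℂ) (φ i) • (pderiv (Sum.inr i)).toLinearMap

/-- The creation field `B(ψ)* = multiplication by Σᵢ ψᵢ Yᵢ`. -/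
noncomputable def BstarOp (d : ℕ) (ψ : Fin d → ℂ) :
    Module.End ℂ (MvPolynomial (Fin d ⊕ Fin d) ℂ) :=
  LinearMap.mulLeft ℂ (∑ i, MvPolynomial.C (ψ i) * X (Sum.inr i))

/-- Componentwise complex conjugation `J` on `ℂ^d`. -/
noncomputable def Jconj (d : ℕ) (φ : Fin d → ℂ) : Fin d → ℂ :=
  fun i => (starRingEnd ℂ) (φ i)

/-- The partial vacuum expectation `ℰ_B : ℂ[X,Y] → ℂ[Y]` with respect to the `X`-modes:
substitute every `Xᵢ := 0`, extracting the part of total `X`-degree zero. -/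
noncomputable def vacAfield (d : ℕ) :
    MvPolynomial (Fin d ⊕ Fin d) ℂ →ₐ[ℂ] MvPolynomial (Fin d ⊕ Fin d) ℂ :=
  aeval (Sum.elim (fun _ => 0) (fun i => X (Sum.inr i)))

/-- `∂/∂Xᵢ + Yᵢ` commutes with `Xⱼ + ∂/∂Yⱼ`: the two canonical commutators cancel. -/
theorem commute_pderiv_add_mulLeft (d : ℕ) (i j : Fin d) :
    Commute (S := Module.End ℂ (MvPolynomial (Fin d ⊕ Fin d) ℂ))
      ((pderiv (Sum.inl i)).toLinearMap + LinearMap.mulLeft ℂ (X (Sum.inr i)))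
      (LinearMap.mulLeft ℂ (X (Sum.inl j)) + (pderiv (Sum.inr j)).toLinearMap) := by
  refine LinearMap.ext fun p => ?_
  have hcomm : pderiv (Sum.inl i) (pderiv (Sum.inr j) p) =
      pderiv (Sum.inr j) (pderiv (Sum.inl i) p) := by
    have h : ⁅pderiv (R := ℂ) (Sum.inl i : Fin d ⊕ Fin d),
        pderiv (R := ℂ) (Sum.inr j : Fin d ⊕ Fin d)⁆ = 0 := by
      refine MvPolynomial.derivation_ext fun k => ?_
      rw [Derivation.commutator_apply]
      simp only [pderiv_X, Pi.single_apply]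
      split_ifs <;> simp
    have h' := congrArg (fun D => D p) h
    simpa [Derivation.commutator_apply, sub_eq_zero] using h'
  simp only [Module.End.mul_apply, LinearMap.add_apply, LinearMap.mulLeft_apply,
    Derivation.coeFn_coe, map_add, Derivation.leibniz, hcomm, pderiv_X, Pi.single_apply,
    smul_eq_mul, Sum.inl.injEq, Sum.inr.injEq, eq_comm (a := j)]
  ring

theorem commute_Zop_ZstarOp (d : ℕ) (φ ψ : Fin d → ℂ) : Commute (Zop d φ) (ZstarOp d ψ) :=
  Commute.sum_left _ _ _ fun i _ => Commute.sum_right _ _ _ fun j _ =>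
    ((commute_pderiv_add_mulLeft d i j).smul_left _).smul_right _

theorem vacAfield_pderiv_inr (d : ℕ) (i : Fin d) (p : MvPolynomial (Fin d ⊕ Fin d) ℂ) :
    vacAfield d (pderiv (Sum.inr i) p) = pderiv (Sum.inr i) (vacAfield d p) := by
  induction p using MvPolynomial.induction_on with
  | C a => simp [vacAfield, algebraMap_eq]
  | add p q hp hq => simp [hp, hq]
  | mul_X p k hp =>
    rw [Derivation.leibniz, map_add, map_mul, Derivation.leibniz]
    simp only [smul_eq_mul, map_mul, hp]
    cases k <;> simp [vacAfield, pderiv_X, Pi.single_apply, apply_ite]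

/-- The partial vacuum expectation intertwines `Z(ψ)*` with `B(Jψ)`. -/
theorem vacAfield_ZstarOp (d : ℕ) (ψ : Fin d → ℂ) (p : MvPolynomial (Fin d ⊕ Fin d) ℂ) :
    vacAfield d (ZstarOp d ψ p) = Bop d (Jconj d ψ) (vacAfield d p) := by
  have hX (i : Fin d) : vacAfield d (X (Sum.inl i)) = 0 := by simp [vacAfield]
  simp [ZstarOp, Bop, Jconj, LinearMap.sum_apply, vacAfield_pderiv_inr, hX]

theorem vacAfield_prod_ZstarOp (d m : ℕ) (ψ : Fin m → Fin d → ℂ)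
    (p : MvPolynomial (Fin d ⊕ Fin d) ℂ) :
    vacAfield d ((List.ofFn fun k => ZstarOp d (ψ k)).prod p) =
      (List.ofFn fun k => Bop d (Jconj d (ψ k))).prod (vacAfield d p) := by
  induction m with
  | zero => simp
  | succ m ih => simp [List.ofFn_succ, vacAfield_ZstarOp, ih]

/-- On polynomials in the `Y`-variables alone, `Z(φ)` acts as `B(Jφ)*`. -/
theorem Zop_apply_of_mem_supported (d : ℕ) (φ : Fin d → ℂ)
    {q : MvPolynomial (Fin d ⊕ Fin d) ℂ}
    (hq : q ∈ supported ℂ (Set.range (Sum.inr : Fin d → Fin d ⊕ Fin d))) :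
    Zop d φ q = BstarOp d (Jconj d φ) q := by
  have h (i : Fin d) : pderiv (Sum.inl i) q = 0 := by
    refine pderiv_eq_zero_of_notMem_vars fun hi => ?_
    simpa using mem_supported.1 hq hi
  simp [Zop, BstarOp, Jconj, LinearMap.sum_apply, h, Finset.sum_mul, smul_eq_C_mul, mul_assoc]

theorem BstarOp_mem_supported (d : ℕ) (φ : Fin d → ℂ)
    {q : MvPolynomial (Fin d ⊕ Fin d) ℂ}
    (hq : q ∈ supported ℂ (Set.range (Sum.inr : Fin d → Fin d ⊕ Fin d))) :
    BstarOp d φ q ∈ supported ℂ (Set.range (Sum.inr : Fin d → Fin d ⊕ Fin d)) :=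
  mul_mem (sum_mem fun i _ => mul_mem (Subalgebra.algebraMap_mem _ (φ i))
    (X_mem_supported.2 ⟨i, rfl⟩)) hq

theorem prod_BstarOp_mem_supported (d n : ℕ) (φ : Fin n → Fin d → ℂ)
    {q : MvPolynomial (Fin d ⊕ Fin d) ℂ}
    (hq : q ∈ supported ℂ (Set.range (Sum.inr : Fin d → Fin d ⊕ Fin d))) :
    (List.ofFn fun j => BstarOp d (φ j)).prod q ∈
      supported ℂ (Set.range (Sum.inr : Fin d → Fin d ⊕ Fin d)) := by
  induction n with
  | zero => simpa using hq
  | succ n ih =>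
    rw [List.ofFn_succ, List.prod_cons, Module.End.mul_apply]
    exact BstarOp_mem_supported d _ (ih _)

theorem prod_Zop_apply_of_mem_supported (d n : ℕ) (φ : Fin n → Fin d → ℂ)
    {q : MvPolynomial (Fin d ⊕ Fin d) ℂ}
    (hq : q ∈ supported ℂ (Set.range (Sum.inr : Fin d → Fin d ⊕ Fin d))) :
    (List.ofFn fun j => Zop d (φ j)).prod q =
      (List.ofFn fun j => BstarOp d (Jconj d (φ j))).prod q := by
  induction n with
  | zero => simp
  | succ n ih =>
    simp only [List.ofFn_succ, List.prod_cons, Module.End.mul_apply, ih]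
    exact Zop_apply_of_mem_supported d _ (prod_BstarOp_mem_supported d n _ hq)

theorem vacAfield_of_mem_supported (d : ℕ) {q : MvPolynomial (Fin d ⊕ Fin d) ℂ}
    (hq : q ∈ supported ℂ (Set.range (Sum.inr : Fin d → Fin d ⊕ Fin d))) :
    vacAfield d q = q := by
  have h : supported ℂ (Set.range (Sum.inr : Fin d → Fin d ⊕ Fin d)) ≤
      AlgHom.equalizer (vacAfield d) (AlgHom.id ℂ _) := by
    refine Algebra.adjoin_le ?_
    rintro _ ⟨_, ⟨i, rfl⟩, rfl⟩
    simp [vacAfield]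
  exact h hq

/-- Partial vacuum expectation with respect to the `A`-modes: for all
`φ₁,…,φₙ, ψ₁,…,ψₘ ∈ ℂ^d` and every `q ∈ ℂ[Y₁,…,Y_d]` (viewed inside `ℂ[X,Y]`),
`ℰ_B(Z(φ₁)⋯Z(φₙ) Z(ψ₁)*⋯Z(ψₘ)* q) = B(Jψ₁)⋯B(Jψₘ) B(Jφ₁)*⋯B(Jφₙ)* q`. -/
theorem antiWick_fields_B (d : ℕ) (hd : 1 ≤ d) (n m : ℕ)
    (φ : Fin n → Fin d → ℂ) (ψ : Fin m → Fin d → ℂ)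
    (q : MvPolynomial (Fin d ⊕ Fin d) ℂ)
    (hq : q ∈ supported ℂ (Set.range (Sum.inr : Fin d → Fin d ⊕ Fin d))) :
    vacAfield d
        (((List.ofFn fun j => Zop d (φ j)).prod * (List.ofFn fun k => ZstarOp d (ψ k)).prod) q)
      = ((List.ofFn fun k => Bop d (Jconj d (ψ k))).prod *
          (List.ofFn fun j => BstarOp d (Jconj d (φ j))).prod) q := by
  have hcomm : Commute (List.ofFn fun j => Zop d (φ j)).prod
      (List.ofFn fun k => ZstarOp d (ψ k)).prod := by
    refine Commute.list_prod_left _ _ fun a ha => Commute.list_prod_right _ _ fun b hb => ?_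
    obtain ⟨j, rfl⟩ := List.mem_ofFn.1 ha
    obtain ⟨k, rfl⟩ := List.mem_ofFn.1 hb
    exact commute_Zop_ZstarOp d (φ j) (ψ k)
  rw [hcomm.eq, Module.End.mul_apply, Module.End.mul_apply, vacAfield_prod_ZstarOp,
    prod_Zop_apply_of_mem_supported d n φ hq,
    vacAfield_of_mem_supported d (prod_BstarOp_mem_supported d n _ hq)]
end
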